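/- Let c_1,...,c_l be integers and let [[alpha, beta],[gamma, delta]] = [[0,-1],[1,0]] * [[c_1,-1],[1,0]] * ... * [[c_l,-1],[1,0]]. If gamma is nonzero, then 3*zeta(Lambda(c_1,...,c_l)) - (c_1 + ... + c_l) = S(alpha/gamma) - (alpha + delta)/gamma, where zeta denotes the signature and S is the Dedekind symbol; if gamma = 0, then 3*zeta(Lambda(c_1,...,c_l)) - (c_1 + ... + c_l) = -beta/alpha. -/

import Mathlib

open scoped Classical

/-- The `l × l` symmetric tridiagonal matrix with diagonal entries `c 0, ..., c (l-1)`
and sub/super-diagonal entries `1`. -/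
def tridiag {l : ℕ} (c : Fin l → ℝ) : Matrix (Fin l) (Fin l) ℝ :=
  Matrix.of fun i j =>
    if i = j then c i else if (i : ℕ) + 1 = (j : ℕ) ∨ (j : ℕ) + 1 = (i : ℕ) then 1 else 0

/-- The associated `2 × 2` matrix
`A(c_1,...,c_l) = [[0,-1],[1,0]] * [[c_1,-1],[1,0]] * ⋯ * [[c_l,-1],[1,0]]`. -/
def assocMat {l : ℕ} (c : Fin l → ℝ) : Matrix (Fin 2) (Fin 2) ℝ :=
  !![0, -1; 1, 0] * (List.ofFn fun i => !![c i, -1; 1, 0]).prod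

/-- The signature of a real symmetric matrix: the number of positive eigenvalues
minus the number of negative eigenvalues. -/
noncomputable def signature {n : Type*} [Fintype n] [DecidableEq n]
    (M : Matrix n n ℝ) : ℤ :=
  if hM : M.IsHermitian then
    ((Finset.univ.filter fun i => 0 < hM.eigenvalues i).card : ℤ)
      - ((Finset.univ.filter fun i => hM.eigenvalues i < 0).card : ℤ)
  else 0

/-- The sawtooth function `((x))`. -/
noncomputable def sawtooth (x : ℝ) : ℝ :=
  if ∃ n : ℤ, x = (n : ℝ) then 0 else x - ⌊x⌋ - 1/2

/-- The Dedekind sum `s(p,q) = ∑_{k=1}^{|q|-1} ((k/q)) ((kp/q))`. -/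
noncomputable def dedekindSum (p q : ℤ) : ℝ :=
  ∑ k ∈ Finset.Icc 1 (q.natAbs - 1),
    sawtooth ((k : ℝ) / (q : ℝ)) * sawtooth ((k : ℝ) * (p : ℝ) / (q : ℝ))

/-- The Dedekind symbol `S(p/q) = 12 sgn(q) s(p,q)`. -/
noncomputable def dedekindSymbol (p q : ℤ) : ℝ :=
  12 * (q.sign : ℝ) * dedekindSum p q

/-- The associated `2 × 2` integer matrix of a tuple of integers. -/
def assocMatZ {l : ℕ} (c : Fin l → ℤ) : Matrix (Fin 2) (Fin 2) ℤ :=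
  !![0, -1; 1, 0] * (List.ofFn fun i => !![c i, -1; 1, 0]).prod

open scoped Matrix

/-! ### Signatures of symmetric matrices -/

/-- Diagonalization of the quadratic form of a real symmetric matrix. -/
theorem Matrix.IsHermitian.equivalent_weightedSumSquares_eigenvalues {n : Type*} [Fintype n]
    [DecidableEq n] {M : Matrix n n ℝ} (hM : M.IsHermitian) :
    M.toQuadraticForm'.Equivalent (QuadraticMap.weightedSumSquares ℝ hM.eigenvalues) := by
  refine ⟨⟨Matrix.UnitaryGroup.toLinearEquiv (star hM.eigenvectorUnitary), fun x => ?_⟩⟩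
  change QuadraticMap.weightedSumSquares ℝ hM.eigenvalues
    ((star (hM.eigenvectorUnitary : Matrix n n ℝ)) *ᵥ x) = _
  have h : x ⬝ᵥ M *ᵥ x = (star (hM.eigenvectorUnitary : Matrix n n ℝ) *ᵥ x) ⬝ᵥ
      (Matrix.diagonal hM.eigenvalues *ᵥ (star (hM.eigenvectorUnitary : Matrix n n ℝ) *ᵥ x)) := by
    conv_lhs => rw [hM.spectral_theorem, Unitary.conjStarAlgAut_apply]
    rw [← Matrix.mulVec_mulVec, ← Matrix.mulVec_mulVec, Matrix.dotProduct_mulVec,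
      ← Matrix.mulVec_transpose, Matrix.star_eq_conjTranspose,
      Matrix.conjTranspose_eq_transpose_of_trivial]
    rfl
  rw [Matrix.toQuadraticForm', LinearMap.BilinMap.toQuadraticMap_apply,
    Matrix.toLinearMap₂'_apply', h, QuadraticMap.weightedSumSquares_apply, dotProduct]
  refine Finset.sum_congr rfl fun i _ => ?_
  rw [Matrix.mulVec_diagonal, smul_eq_mul]
  ring

theorem signature_eq_sigPos_sub_sigNeg {n : Type*} [Fintype n] [DecidableEq n]
    {M : Matrix n n ℝ} (hM : M.IsHermitian) :
    signature M = (sigPos M.toQuadraticForm' : ℤ) - sigNeg M.toQuadraticForm' := by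
  have h := hM.equivalent_weightedSumSquares_eigenvalues
  rw [signature, dif_pos hM, QuadraticForm.sigPos_of_equiv_weightedSumSquares h,
    QuadraticForm.sigNeg_of_equiv_weightedSumSquares h, Set.ncard_eq_toFinset_card',
    Set.ncard_eq_toFinset_card', Set.toFinset_ofPred, Set.toFinset_ofPred]

theorem sigPos_add_sigNeg_eq_card_of_det_ne_zero {n : Type*} [Fintype n] [DecidableEq n]
    {M : Matrix n n ℝ} (hM : M.IsHermitian) (hdet : M.det ≠ 0) :
    sigPos M.toQuadraticForm' + sigNeg M.toQuadraticForm' = Fintype.card n := by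
  have h := hM.equivalent_weightedSumSquares_eigenvalues
  rw [hM.det_eq_prod_eigenvalues, Finset.prod_ne_zero_iff] at hdet
  rw [QuadraticForm.sigPos_of_equiv_weightedSumSquares h,
    QuadraticForm.sigNeg_of_equiv_weightedSumSquares h, ← Nat.card_eq_fintype_card,
    ← Set.ncard_add_ncard_compl {i | 0 < hM.eigenvalues i}]
  congr 2
  ext i
  have hi : hM.eigenvalues i ≠ 0 := by simpa using hdet i (Finset.mem_univ i)
  simp [le_iff_lt_or_eq, hi]

theorem sigPos_add_sigNeg_lt_card_of_det_eq_zero {n : Type*} [Fintype n] [DecidableEq n]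
    {M : Matrix n n ℝ} (hM : M.IsHermitian) (hdet : M.det = 0) :
    sigPos M.toQuadraticForm' + sigNeg M.toQuadraticForm' < Fintype.card n := by
  have h := hM.equivalent_weightedSumSquares_eigenvalues
  rw [hM.det_eq_prod_eigenvalues, Finset.prod_eq_zero_iff] at hdet
  obtain ⟨i, -, hi⟩ := hdet
  have hi : hM.eigenvalues i = 0 := by simpa using hi
  rw [QuadraticForm.sigPos_of_equiv_weightedSumSquares h,
    QuadraticForm.sigNeg_of_equiv_weightedSumSquares h, ← Nat.card_eq_fintype_card,
    ← Set.ncard_add_ncard_compl {i | 0 < hM.eigenvalues i}]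
  refine Nat.add_lt_add_left (Set.ncard_lt_ncard ⟨fun j hj => ?_, fun hsub => ?_⟩) _
  · simpa using (show hM.eigenvalues j < 0 from hj).le
  · have : hM.eigenvalues i < 0 := hsub (by simp [hi])
    exact this.ne hi

theorem sign_det_eq_neg_one_pow_sigNeg {n : Type*} [Fintype n] [DecidableEq n]
    {M : Matrix n n ℝ} (hM : M.IsHermitian) (hdet : M.det ≠ 0) :
    SignType.sign M.det = (-1) ^ sigNeg M.toQuadraticForm' := by
  have h := hM.equivalent_weightedSumSquares_eigenvalues
  have hdet' := hdet
  rw [hM.det_eq_prod_eigenvalues, Finset.prod_ne_zero_iff] at hdet'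
  have hsign : SignType.sign M.det = ∏ i, SignType.sign (hM.eigenvalues i) := by
    rw [hM.det_eq_prod_eigenvalues]
    exact map_prod signHom _ _
  rw [hsign, QuadraticForm.sigNeg_of_equiv_weightedSumSquares h,
    Set.ncard_eq_toFinset_card', Set.toFinset_ofPred, ← Finset.prod_const, Finset.prod_filter]
  refine Finset.prod_congr rfl fun i _ => ?_
  have hi : hM.eigenvalues i ≠ 0 := by simpa using hdet' i (Finset.mem_univ i)
  rcases lt_or_gt_of_ne hi with hlt | hgt
  · simp [hlt, sign_neg hlt]
  · simp [hgt.not_gt, sign_pos hgt]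

theorem sigPos_comp_le {E F : Type*} [AddCommGroup E] [Module ℝ E] [AddCommGroup F] [Module ℝ F]
    [FiniteDimensional ℝ E] [FiniteDimensional ℝ F] (Q : QuadraticForm ℝ F) (f : E →ₗ[ℝ] F)
    (hf : Function.Injective f) : sigPos (Q.comp f) ≤ sigPos Q := by
  obtain ⟨V, hV, hpos⟩ := exists_finrank_eq_sigPos_and_posDef (Q.comp f)
  rw [← hV, (Submodule.equivMapOfInjective f hf V).finrank_eq]
  refine le_sigPos_of_posDef Q ?_
  rintro ⟨_, x, hx, rfl⟩ hne
  refine hpos ⟨x, hx⟩ fun h0 => hne ?_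
  have : x = 0 := by simpa using h0
  simp [this]

theorem sigPos_add_finrank_le_sigPos_comp_add_finrank {E F : Type*} [AddCommGroup E] [Module ℝ E]
    [AddCommGroup F] [Module ℝ F] [FiniteDimensional ℝ E] [FiniteDimensional ℝ F]
    (Q : QuadraticForm ℝ F) (f : E →ₗ[ℝ] F) (hf : Function.Injective f) :
    sigPos Q + Module.finrank ℝ E ≤ sigPos (Q.comp f) + Module.finrank ℝ F := by
  obtain ⟨V, hV, hpos⟩ := exists_finrank_eq_sigPos_and_posDef Q
  have hcomap : ((Q.comp f).restrict (V.comap f)).PosDef := by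
    rintro ⟨x, hx⟩ hne
    refine hpos ⟨f x, hx⟩ fun h0 => hne ?_
    have : f x = f 0 := by simpa using h0
    simpa using hf this
  have hle := le_sigPos_of_posDef _ hcomap
  rw [(Submodule.equivMapOfInjective f hf _).finrank_eq, Submodule.map_comap_eq] at hle
  have hdim := Submodule.finrank_sup_add_finrank_inf_eq (LinearMap.range f) V
  have hsup := (LinearMap.range f ⊔ V).finrank_le
  rw [LinearMap.finrank_range_of_inj hf] at hdim
  omega

/-- The quadratic form of a principal submatrix is a restriction. -/
theorem toQuadraticForm'_submatrix_succ {l : ℕ} (M : Matrix (Fin (l + 1)) (Fin (l + 1)) ℝ) :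
    (M.submatrix Fin.succ Fin.succ).toQuadraticForm' =
      M.toQuadraticForm'.comp (LinearMap.vecCons 0 LinearMap.id) := by
  ext x
  simp [Matrix.toQuadraticForm', Matrix.toLinearMap₂'_apply', dotProduct, Matrix.mulVec,
    Fin.sum_univ_succ]

theorem signature_eq_submatrix_succ_add_sign {l : ℕ} {M : Matrix (Fin (l + 1)) (Fin (l + 1)) ℝ}
    (hM : M.IsHermitian)
    (hdet : M.det ≠ 0 ∨ (M.submatrix Fin.succ Fin.succ).det ≠ 0) :
    signature M = signature (M.submatrix Fin.succ Fin.succ) +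
      SignType.sign (M.det * (M.submatrix Fin.succ Fin.succ).det) := by
  have hN : (M.submatrix Fin.succ Fin.succ).IsHermitian := hM.submatrix _
  set N := M.submatrix Fin.succ Fin.succ
  have hinj : Function.Injective
      (LinearMap.vecCons (0 : (Fin l → ℝ) →ₗ[ℝ] ℝ) LinearMap.id) := fun x y h => by
    funext i
    simpa using congrFun h i.succ
  have hQ : N.toQuadraticForm' = M.toQuadraticForm'.comp (LinearMap.vecCons 0 LinearMap.id) :=
    toQuadraticForm'_submatrix_succ M
  have hp := sigPos_comp_le M.toQuadraticForm' _ hinj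
  have hp' := sigPos_add_finrank_le_sigPos_comp_add_finrank M.toQuadraticForm' _ hinj
  have hn := sigPos_comp_le (-M.toQuadraticForm') _ hinj
  have hn' := sigPos_add_finrank_le_sigPos_comp_add_finrank (-M.toQuadraticForm') _ hinj
  rw [← hQ] at hp hp'
  have hQneg : (-M.toQuadraticForm').comp (LinearMap.vecCons 0 LinearMap.id) =
      -N.toQuadraticForm' := by rw [hQ]; rfl
  rw [hQneg, sigPos_neg, sigPos_neg] at hn hn'
  rw [Module.finrank_fin_fun, Module.finrank_fin_fun] at hp' hn'
  rw [signature_eq_sigPos_sub_sigNeg hM, signature_eq_sigPos_sub_sigNeg hN]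
  by_cases h1 : M.det = 0
  · have a := sigPos_add_sigNeg_lt_card_of_det_eq_zero hM h1
    have b := sigPos_add_sigNeg_eq_card_of_det_ne_zero hN (by tauto)
    rw [Fintype.card_fin] at a b
    simp only [h1, zero_mul, sign_zero, SignType.coe_zero]
    omega
  have a := sigPos_add_sigNeg_eq_card_of_det_ne_zero hM h1
  rw [Fintype.card_fin] at a
  by_cases h2 : N.det = 0
  · have b := sigPos_add_sigNeg_lt_card_of_det_eq_zero hN h2
    rw [Fintype.card_fin] at b
    simp only [h2, mul_zero, sign_zero, SignType.coe_zero]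
    omega
  · have b := sigPos_add_sigNeg_eq_card_of_det_ne_zero hN h2
    rw [Fintype.card_fin] at b
    rw [sign_mul, sign_det_eq_neg_one_pow_sigNeg hM h1, sign_det_eq_neg_one_pow_sigNeg hN h2,
      ← pow_add]
    obtain h | h : sigNeg M.toQuadraticForm' = sigNeg N.toQuadraticForm' ∨
        sigNeg M.toQuadraticForm' = sigNeg N.toQuadraticForm' + 1 := by omega
    · rw [h, Even.neg_one_pow ⟨_, rfl⟩, SignType.coe_one]
      omega
    · rw [h, Odd.neg_one_pow ⟨sigNeg N.toQuadraticForm', by ring⟩, SignType.coe_neg_one]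
      omega

/-! ### Tridiagonal matrices and the associated `2 × 2` matrices -/

theorem tridiag_isHermitian {l : ℕ} (c : Fin l → ℝ) : (tridiag c).IsHermitian := by
  ext i j
  by_cases h : i = j
  · simp [h]
  · simp [tridiag, h, Ne.symm h, or_comm]

theorem tridiag_submatrix_succ {l : ℕ} (c : Fin (l + 1) → ℝ) :
    (tridiag c).submatrix Fin.succ Fin.succ = tridiag fun i => c i.succ := by
  ext i j
  simp [tridiag]

theorem det_tridiag_succ_succ {l : ℕ} (c : Fin (l + 2) → ℝ) :
    (tridiag c).det = c 0 * (tridiag fun i => c i.succ).det -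
      (tridiag fun i => c i.succ.succ).det := by
  have hminor : ((tridiag c).submatrix Fin.succ (Fin.succAbove 1)).det =
      (tridiag fun i => c i.succ.succ).det := by
    rw [Matrix.det_succ_column_zero, Fin.sum_univ_succ, Finset.sum_eq_zero]
    · have : ((tridiag c).submatrix Fin.succ (Fin.succAbove 1)).submatrix
          (Fin.succAbove 0) Fin.succ = tridiag fun i => c i.succ.succ := by
        ext i j
        simp [tridiag, Fin.succAbove_of_le_castSucc, Fin.ext_iff, Fin.le_def]
      rw [this]
      simp [tridiag]
    · intro i _
      simp [tridiag, Fin.ext_iff]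
  rw [Matrix.det_succ_row_zero, Fin.sum_univ_succ, Fin.sum_univ_succ, Finset.sum_eq_zero]
  · simp only [Fin.succ_zero_eq_one, hminor, Fin.succAbove_zero, tridiag_submatrix_succ]
    simp [tridiag, Fin.ext_iff]
    ring
  · intro i _
    simp [tridiag, Fin.ext_iff]

theorem assocMatZ_succ {l : ℕ} (c : Fin (l + 1) → ℤ) :
    assocMatZ c = !![0, -1; 1, c 0] * assocMatZ fun i => c i.succ := by
  rw [assocMatZ, assocMatZ, List.ofFn_succ, List.prod_cons, ← mul_assoc, ← mul_assoc]
  congr 1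
  simp

theorem assocMatZ_succ_zero {l : ℕ} (c : Fin (l + 1) → ℤ) (j : Fin 2) :
    assocMatZ c 0 j = -assocMatZ (fun i => c i.succ) 1 j := by
  simp [assocMatZ_succ c, Matrix.vecMul, dotProduct, Fin.sum_univ_two]

theorem assocMatZ_succ_one {l : ℕ} (c : Fin (l + 1) → ℤ) (j : Fin 2) :
    assocMatZ c 1 j =
      assocMatZ (fun i => c i.succ) 0 j + c 0 * assocMatZ (fun i => c i.succ) 1 j := by
  simp [assocMatZ_succ c, Matrix.vecMul, dotProduct, Fin.sum_univ_two]

theorem det_assocMatZ {l : ℕ} (c : Fin l → ℤ) : (assocMatZ c).det = 1 := by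
  induction l with
  | zero => simp [assocMatZ]
  | succ l ih => rw [assocMatZ_succ, Matrix.det_mul, ih]; simp

theorem assocMatZ_one_zero_eq_det {l : ℕ} (c : Fin l → ℤ) :
    (assocMatZ c 1 0 : ℝ) = (tridiag fun i => (c i : ℝ)).det := by
  induction l using Nat.twoStepInduction with
  | zero => simp [assocMatZ]
  | one => simp [assocMatZ, tridiag]
  | more l ih₀ ih₁ =>
    rw [det_tridiag_succ_succ, ← ih₁ fun i => c i.succ, ← ih₀ fun i => c i.succ.succ,
      assocMatZ_succ_one c, assocMatZ_succ_zero fun i => c i.succ]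
    push_cast
    ring

theorem signature_tridiag_succ {l : ℕ} (c : Fin (l + 1) → ℤ) :
    signature (tridiag fun i => (c i : ℝ)) =
      signature (tridiag fun i : Fin l => (c i.succ : ℝ)) +
        (assocMatZ c 1 0 * assocMatZ (fun i => c i.succ) 1 0).sign := by
  have h := signature_eq_submatrix_succ_add_sign (tridiag_isHermitian fun i => (c i : ℝ))
  rw [tridiag_submatrix_succ, ← assocMatZ_one_zero_eq_det c,
    ← assocMatZ_one_zero_eq_det fun i => c i.succ] at h
  rw [h, Int.sign_eq_sign, ← Int.cast_mul, sign_intCast]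
  have hdet := det_assocMatZ fun i => c i.succ
  by_contra! h0
  norm_cast at h0
  obtain ⟨h0, h1⟩ := h0
  rw [assocMatZ_succ_one, h1, mul_zero, add_zero] at h0
  simp [Matrix.det_fin_two, h0, h1] at hdet

/-! ### Dedekind sums -/

theorem sawtooth_neg (x : ℝ) : sawtooth (-x) = -sawtooth x := by
  unfold sawtooth
  by_cases h : ∃ n : ℤ, x = n
  · obtain ⟨n, rfl⟩ := h
    rw [if_pos ⟨-n, by push_cast; rfl⟩, if_pos ⟨n, rfl⟩, neg_zero]
  · have h' : ¬∃ n : ℤ, -x = n := by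
      rintro ⟨n, hn⟩
      exact h ⟨-n, by push_cast; linarith⟩
    have hfr : Int.fract x ≠ 0 := fun h0 => by
      obtain ⟨n, hn⟩ := Int.fract_eq_zero_iff.mp h0
      exact h ⟨n, hn.symm⟩
    have := Int.fract_neg hfr
    rw [if_neg h, if_neg h']
    unfold Int.fract at this
    linarith

theorem sawtooth_add_intCast (x : ℝ) (m : ℤ) : sawtooth (x + m) = sawtooth x := by
  have h : (∃ n : ℤ, x + m = n) ↔ ∃ n : ℤ, x = n :=
    ⟨fun ⟨n, hn⟩ => ⟨n - m, by push_cast; linarith⟩, fun ⟨n, hn⟩ => ⟨n + m, by push_cast; linarith⟩⟩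
  unfold sawtooth
  simp only [h, Int.floor_add_intCast]
  push_cast
  ring_nf

theorem sawtooth_natCast_div {m q : ℕ} (hq : 0 < q) (h : ¬q ∣ m) :
    sawtooth ((m : ℝ) / q) = ((m % q : ℕ) : ℝ) / q - 1 / 2 := by
  have hfr : Int.fract ((m : ℝ) / q) = ((m % q : ℕ) : ℝ) / q :=
    Int.fract_div_natCast_eq_div_natCast_mod
  have hne : ((m % q : ℕ) : ℝ) / q ≠ 0 := by
    have : m % q ≠ 0 := fun h0 => h (Nat.dvd_of_mod_eq_zero h0)
    positivity
  rw [sawtooth, if_neg, ← hfr, Int.fract]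
  rintro ⟨n, hn⟩
  rw [hn, Int.fract_intCast] at hfr
  exact hne hfr.symm

theorem dedekindSum_neg_left (p q : ℤ) : dedekindSum (-p) q = -dedekindSum p q := by
  simp [dedekindSum, neg_div, sawtooth_neg]

theorem dedekindSum_neg_right (p q : ℤ) : dedekindSum p (-q) = dedekindSum p q := by
  simp [dedekindSum, div_neg, sawtooth_neg]

theorem dedekindSymbol_neg_left (p q : ℤ) : dedekindSymbol (-p) q = -dedekindSymbol p q := by
  simp [dedekindSymbol, dedekindSum_neg_left]

theorem dedekindSymbol_neg_right (p q : ℤ) : dedekindSymbol p (-q) = -dedekindSymbol p q := by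
  simp [dedekindSymbol, dedekindSum_neg_right]

theorem dedekindSymbol_add_mul_left (p q m : ℤ) :
    dedekindSymbol (p + m * q) q = dedekindSymbol p q := by
  rcases eq_or_ne q 0 with rfl | hq
  · simp
  have hq' : (q : ℝ) ≠ 0 := by exact_mod_cast hq
  unfold dedekindSymbol dedekindSum
  congr 1
  refine Finset.sum_congr rfl fun k _ => ?_
  rw [← sawtooth_add_intCast ((k : ℝ) * p / q) (k * m)]
  congr 2
  push_cast
  field_simp

theorem dedekindSymbol_of_natAbs_eq_one (p : ℤ) {q : ℤ} (hq : q.natAbs = 1) :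
    dedekindSymbol p q = 0 := by
  simp [dedekindSymbol, dedekindSum, hq]

theorem sum_Ico_mul_mod {p q : ℕ} (h : p.Coprime q) (F : ℕ → ℝ) :
    ∑ k ∈ Finset.Ico 1 q, F (k * p % q) = ∑ k ∈ Finset.Ico 1 q, F k := by
  have hmaps : Set.MapsTo (fun k => k * p % q) (Finset.Ico 1 q) (Finset.Ico 1 q) := by
    intro k hk
    simp only [Finset.coe_Ico, Set.mem_Ico] at hk ⊢
    refine ⟨Nat.pos_of_ne_zero fun h0 => ?_, Nat.mod_lt _ (by omega)⟩
    have := Nat.le_of_dvd hk.1 (h.symm.dvd_of_dvd_mul_right (Nat.dvd_of_mod_eq_zero h0))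
    omega
  have hinj : Set.InjOn (fun k => k * p % q) (Finset.Ico 1 q) := by
    intro a ha b hb hab
    simp only [Finset.coe_Ico, Set.mem_Ico] at ha hb
    exact (Nat.ModEq.cancel_right_of_coprime h.symm hab).eq_of_lt_of_lt ha.2 hb.2
  exact Finset.sum_nbij (fun k => k * p % q) hmaps hinj
    (Finset.surjOn_of_injOn_of_card_le _ hmaps hinj le_rfl) fun _ _ => rfl

theorem filter_mul_lt_mul_eq_Ico {p q k : ℕ} (h : p.Coprime q) (hk : k ∈ Finset.Ico 1 q) :
    (Finset.Ico 1 p).filter (fun j => j * q < k * p) = Finset.Ico 1 (k * p / q + 1) := by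
  obtain ⟨hk1, hkq⟩ := Finset.mem_Ico.mp hk
  ext j
  simp only [Finset.mem_filter, Finset.mem_Ico, Nat.lt_succ_iff,
    Nat.le_div_iff_mul_le (by omega : 0 < q)]
  constructor
  · rintro ⟨⟨h1, -⟩, h2⟩
    exact ⟨h1, h2.le⟩
  · rintro ⟨h1, h2⟩
    have hne : j * q ≠ k * p := fun he => by
      have := Nat.le_of_dvd hk1 (h.symm.dvd_of_dvd_mul_right (Dvd.intro_left j he))
      omega
    refine ⟨⟨h1, ?_⟩, lt_of_le_of_ne h2 hne⟩
    by_contra! hpj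
    nlinarith

/-- Summing `j` over the lattice rectangle, split along its diagonal. -/
theorem sum_floor_mul_floor_add_one_add {p q : ℕ} (h : p.Coprime q) :
    ∑ k ∈ Finset.Ico 1 q, (((k * p / q : ℕ) : ℝ) * (((k * p / q : ℕ) : ℝ) + 1)) +
      2 * ∑ j ∈ Finset.Ico 1 p, (j : ℝ) * ((j * q / p : ℕ) : ℝ) =
      2 * ∑ _k ∈ Finset.Ico 1 q, ∑ j ∈ Finset.Ico 1 p, (j : ℝ) := by
  have hgauss (n : ℕ) : ∑ j ∈ Finset.Ico 1 (n + 1), (j : ℝ) = n * (n + 1) / 2 := by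
    induction n with
    | zero => simp
    | succ n ih => rw [Finset.sum_Ico_succ_top (by omega), ih]; push_cast; ring
  have hlow : ∑ k ∈ Finset.Ico 1 q, (((k * p / q : ℕ) : ℝ) * (((k * p / q : ℕ) : ℝ) + 1)) =
      2 * ∑ k ∈ Finset.Ico 1 q, ∑ j ∈ Finset.Ico 1 p, if j * q < k * p then (j : ℝ) else 0 := by
    rw [Finset.mul_sum]
    refine Finset.sum_congr rfl fun k hk => ?_
    rw [← Finset.sum_filter, filter_mul_lt_mul_eq_Ico h hk, hgauss]
    ring
  have hhigh : ∑ j ∈ Finset.Ico 1 p, (j : ℝ) * ((j * q / p : ℕ) : ℝ) =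
      ∑ k ∈ Finset.Ico 1 q, ∑ j ∈ Finset.Ico 1 p, if k * p < j * q then (j : ℝ) else 0 := by
    rw [Finset.sum_comm]
    refine Finset.sum_congr rfl fun j hj => ?_
    rw [← Finset.sum_filter, filter_mul_lt_mul_eq_Ico h.symm hj]
    simp [mul_comm]
  rw [hlow, hhigh, ← mul_add, ← Finset.sum_add_distrib]
  congr 1
  refine Finset.sum_congr rfl fun k hk => ?_
  rw [← Finset.sum_add_distrib]
  refine Finset.sum_congr rfl fun j hj => ?_
  obtain ⟨hk1, hkq⟩ := Finset.mem_Ico.mp hk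
  have hne : j * q ≠ k * p := fun he => by
    have := Nat.le_of_dvd hk1 (h.symm.dvd_of_dvd_mul_right (Dvd.intro_left j he))
    omega
  rcases lt_or_gt_of_ne hne with hlt | hgt
  · simp [hlt, hlt.not_gt]
  · simp [hgt, hgt.not_gt]

theorem sum_Ico_cast {n : ℕ} (hn : 0 < n) :
    ∑ k ∈ Finset.Ico 1 n, (k : ℝ) = n * (n - 1) / 2 := by
  induction n, hn using Nat.le_induction with
  | base => simp
  | succ n hn ih => rw [Finset.sum_Ico_succ_top hn, ih]; push_cast; ring

theorem sum_Ico_cast_sq {n : ℕ} (hn : 0 < n) :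
    ∑ k ∈ Finset.Ico 1 n, (k : ℝ) ^ 2 = n * (n - 1) * (2 * n - 1) / 6 := by
  induction n, hn using Nat.le_induction with
  | base => simp
  | succ n hn ih => rw [Finset.sum_Ico_succ_top hn, ih]; push_cast; ring

theorem cast_mul_mod (k p q : ℕ) :
    ((k * p % q : ℕ) : ℝ) = k * p - q * ((k * p / q : ℕ) : ℝ) := by
  have := congrArg (Nat.cast (R := ℝ)) (Nat.mod_add_div (k * p) q)
  push_cast at this ⊢
  linarith

theorem sum_floor {p q : ℕ} (hq : 0 < q) (h : p.Coprime q) :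
    ∑ k ∈ Finset.Ico 1 q, ((k * p / q : ℕ) : ℝ) = (p - 1) * (q - 1) / 2 := by
  have hmod := sum_Ico_mul_mod h fun k => (k : ℝ)
  simp only [cast_mul_mod, Finset.sum_sub_distrib, ← Finset.sum_mul, ← Finset.mul_sum,
    sum_Ico_cast hq] at hmod
  have hq' : (q : ℝ) ≠ 0 := by positivity
  apply mul_left_cancel₀ hq'
  linarith

theorem sum_floor_sq {p q : ℕ} (hq : 0 < q) (h : p.Coprime q) :
    (p ^ 2 - 1) * (q * (q - 1) * (2 * q - 1) / 6 : ℝ) +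
      q ^ 2 * ∑ k ∈ Finset.Ico 1 q, ((k * p / q : ℕ) : ℝ) ^ 2 =
      2 * p * q * ∑ k ∈ Finset.Ico 1 q, (k : ℝ) * ((k * p / q : ℕ) : ℝ) := by
  have hmod := sum_Ico_mul_mod h fun k => (k : ℝ) ^ 2
  have hexp : ∀ k : ℕ, ((k * p % q : ℕ) : ℝ) ^ 2 = p ^ 2 * (k : ℝ) ^ 2 -
      2 * p * q * ((k : ℝ) * ((k * p / q : ℕ) : ℝ)) + q ^ 2 * ((k * p / q : ℕ) : ℝ) ^ 2 := by
    intro k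
    rw [cast_mul_mod]
    ring
  simp only [hexp, Finset.sum_sub_distrib, Finset.sum_add_distrib, ← Finset.mul_sum,
    sum_Ico_cast_sq hq] at hmod
  linarith

theorem dedekindSum_natCast {p q : ℕ} (hq : 0 < q) (h : p.Coprime q) :
    dedekindSum p q = p * ((q - 1) * (2 * q - 1)) / (6 * q) -
      (∑ k ∈ Finset.Ico 1 q, (k : ℝ) * ((k * p / q : ℕ) : ℝ)) / q - (q - 1) / 4 := by
  have hq' : (q : ℝ) ≠ 0 := by positivity
  have hIcc : Finset.Icc 1 ((q : ℤ).natAbs - 1) = Finset.Ico 1 q := by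
    ext k
    simp only [Int.natAbs_natCast, Finset.mem_Icc, Finset.mem_Ico]
    omega
  have hterm : ∀ k ∈ Finset.Ico 1 q,
      sawtooth ((k : ℝ) / ((q : ℤ) : ℝ)) * sawtooth ((k : ℝ) * ((p : ℤ) : ℝ) / ((q : ℤ) : ℝ)) =
      p / q ^ 2 * (k : ℝ) ^ 2 - 1 / q * ((k : ℝ) * ((k * p / q : ℕ) : ℝ)) -
        (1 + p) / (2 * q) * (k : ℝ) + 1 / 2 * ((k * p / q : ℕ) : ℝ) + 1 / 4 := by
    intro k hk
    obtain ⟨hk1, hkq⟩ := Finset.mem_Ico.mp hk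
    have hdvd : ¬q ∣ k := Nat.not_dvd_of_pos_of_lt hk1 hkq
    have hdvd' : ¬q ∣ k * p := fun hd => hdvd (h.symm.dvd_of_dvd_mul_right hd)
    have hsaw := sawtooth_natCast_div hq hdvd'
    rw [cast_mul_mod, Nat.cast_mul] at hsaw
    rw [Int.cast_natCast, Int.cast_natCast, sawtooth_natCast_div hq hdvd, hsaw,
      Nat.mod_eq_of_lt hkq]
    field_simp
    ring
  rw [dedekindSum, hIcc, Finset.sum_congr rfl hterm]
  simp only [Finset.sum_add_distrib, Finset.sum_sub_distrib, ← Finset.mul_sum, sum_Ico_cast hq,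
    sum_Ico_cast_sq hq, sum_floor hq h, Finset.sum_const, Nat.card_Ico, nsmul_eq_mul,
    Nat.cast_pred hq]
  field_simp
  ring

/-- Dedekind reciprocity for positive integers. -/
theorem dedekindSum_reciprocity {p q : ℕ} (hp : 0 < p) (hq : 0 < q) (h : p.Coprime q) :
    12 * (dedekindSum p q + dedekindSum q p) = (p : ℝ) / q + q / p + 1 / (p * q) - 3 := by
  have hp' : (p : ℝ) ≠ 0 := by positivity
  have hq' : (q : ℝ) ≠ 0 := by positivity
  rw [dedekindSum_natCast hq h, dedekindSum_natCast hp h.symm]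
  have hsq := sum_floor_sq hq h
  have hrect := sum_floor_mul_floor_add_one_add h
  simp only [mul_add, mul_one, ← pow_two, Finset.sum_add_distrib, sum_floor hq h,
    sum_Ico_cast hp, Finset.sum_const, Nat.card_Ico, nsmul_eq_mul, Nat.cast_pred hq] at hrect
  set A := ∑ k ∈ Finset.Ico 1 q, (k : ℝ) * ((k * p / q : ℕ) : ℝ)
  set B := ∑ k ∈ Finset.Ico 1 p, (k : ℝ) * ((k * q / p : ℕ) : ℝ)
  set F := ∑ k ∈ Finset.Ico 1 q, ((k * p / q : ℕ) : ℝ) ^ 2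
  have hF : F = (q - 1) * p * (p - 1) - 2 * B - (p - 1) * (q - 1) / 2 := by linarith
  have hA : A = ((p ^ 2 - 1) * (q * (q - 1) * (2 * q - 1) / 6) + q ^ 2 * F) / (2 * p * q) := by
    rw [hsq]
    field_simp
  rw [hA, hF]
  field_simp
  ring

theorem dedekindSymbol_reciprocity {p q : ℤ} (hp : p ≠ 0) (hq : q ≠ 0) (h : IsCoprime p q) :
    dedekindSymbol p q + dedekindSymbol q p =
      (p : ℝ) / q + q / p + 1 / (p * q) - 3 * ((p * q).sign : ℝ) := by
  have key : ∀ a b : ℕ, 0 < a → 0 < b → a.Coprime b →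
      dedekindSymbol a b + dedekindSymbol b a = (a : ℝ) / b + b / a + 1 / (a * b) - 3 := by
    intro a b ha hb hab
    rw [← dedekindSum_reciprocity ha hb hab, dedekindSymbol,
      dedekindSymbol, Int.sign_natCast_of_ne_zero ha.ne', Int.sign_natCast_of_ne_zero hb.ne']
    push_cast
    ring
  obtain ⟨a, ha⟩ := Int.eq_nat_or_neg p
  obtain ⟨b, hb⟩ := Int.eq_nat_or_neg q
  have ha0 : 0 < a := by omega
  have hb0 : 0 < b := by omega
  have hsa := Int.sign_natCast_of_ne_zero ha0.ne'
  have hsb := Int.sign_natCast_of_ne_zero hb0.ne'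
  have hcop : a.Coprime b := by
    rw [Int.isCoprime_iff_gcd_eq_one] at h
    rcases ha with rfl | rfl <;> rcases hb with rfl | rfl <;> simpa using h
  have hab := key a b ha0 hb0 hcop
  rcases ha with rfl | rfl <;> rcases hb with rfl | rfl <;>
    simp only [dedekindSymbol_neg_left, dedekindSymbol_neg_right, Int.sign_mul, Int.sign_neg,
      hsa, hsb] <;>
    push_cast <;>
    simp only [div_neg, neg_div, neg_mul, mul_neg, mul_one] <;>
    linarith

/-- Kirby--Melvin: for integers `c_1,...,c_l` with associated `2 × 2` matrix
`[[α,β],[γ,δ]]`, one has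
`3 ζ(Λ) - tr(Λ) = S(α/γ) - (α+δ)/γ` if `γ ≠ 0`, and `3 ζ(Λ) - tr(Λ) = -β/α`
if `γ = 0`. -/
theorem kirby_melvin {l : ℕ} (c : Fin l → ℤ) :
    (assocMatZ c 1 0 ≠ 0 →
      3 * (signature (tridiag fun i => (c i : ℝ)) : ℝ) - ∑ i, (c i : ℝ) =
        dedekindSymbol (assocMatZ c 0 0) (assocMatZ c 1 0)
          - ((assocMatZ c 0 0 : ℝ) + (assocMatZ c 1 1 : ℝ)) / (assocMatZ c 1 0 : ℝ)) ∧
    (assocMatZ c 1 0 = 0 →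
      3 * (signature (tridiag fun i => (c i : ℝ)) : ℝ) - ∑ i, (c i : ℝ) =
        -(assocMatZ c 0 1 : ℝ) / (assocMatZ c 0 0 : ℝ)) := by
  induction l with
  | zero => simp [assocMatZ, signature, tridiag, dedekindSymbol, dedekindSum]
  | succ l ih =>
    obtain ⟨ih₁, ih₀⟩ := ih fun i => c i.succ
    have hdet := det_assocMatZ fun i => c i.succ
    rw [Matrix.det_fin_two] at hdet
    rw [signature_tridiag_succ, Fin.sum_univ_succ, assocMatZ_succ_one, assocMatZ_succ_one,
      assocMatZ_succ_zero, assocMatZ_succ_zero]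
    generalize assocMatZ (fun i => c i.succ) 0 0 = α at *
    generalize assocMatZ (fun i => c i.succ) 0 1 = β at *
    generalize assocMatZ (fun i => c i.succ) 1 0 = γ at *
    generalize assocMatZ (fun i => c i.succ) 1 1 = δ at *
    generalize signature (tridiag fun i : Fin l => (c i.succ : ℝ)) = ζ at *
    generalize ∑ i : Fin l, (c i.succ : ℝ) = t at *
    generalize c 0 = x at *
    have hdet' : (α : ℝ) * δ - β * γ = 1 := by exact_mod_cast hdet
    refine ⟨fun hγ' => ?_, fun hγ' => ?_⟩
    · rcases eq_or_ne γ 0 with rfl | hγ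
      · have ih := ih₀ rfl
        have hα : α = 1 ∨ α = -1 := Int.isUnit_iff.mp (.of_mul_eq_one δ (by linarith))
        rw [dedekindSymbol_of_natAbs_eq_one _ (by rcases hα with rfl | rfl <;> simp)]
        rcases hα with rfl | rfl
        · obtain rfl : δ = 1 := by linarith
          simp at ih ⊢
          linarith
        · obtain rfl : δ = -1 := by linarith
          simp at ih ⊢
          linarith
      · have ih := ih₁ hγ
        have hcop : IsCoprime γ (α + x * γ) := ⟨-β - x * δ, δ, by linarith⟩
        have hrec := dedekindSymbol_reciprocity hγ hγ' hcop
        rw [dedekindSymbol_add_mul_left] at hrec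
        rw [dedekindSymbol_neg_left]
        have h₁ : (γ : ℝ) ≠ 0 := by exact_mod_cast hγ
        have h₂ : (α + x * γ : ℝ) ≠ 0 := by exact_mod_cast hγ'
        rw [mul_comm γ] at hrec
        push_cast at hrec ⊢
        have hfrac : (-(γ : ℝ) + (β + x * δ)) / (α + x * γ) = (α + δ : ℝ) / γ + x
            - γ / (α + x * γ) - (α + x * γ) / γ - 1 / (γ * (α + x * γ)) := by
          generalize hg : (α + x * γ : ℝ) = g at h₂ ⊢
          field_simp
          linear_combination -hdet' + (δ - g) * hg
        rw [hfrac]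
        linarith
    · have hα : α = -(x * γ) := by linarith
      have hγ : γ = 1 ∨ γ = -1 :=
        Int.isUnit_iff.mp (.of_mul_eq_one (-(x * δ) - β) (by rw [hα] at hdet; linarith))
      have ih := ih₁ (by rcases hγ with rfl | rfl <;> simp)
      rw [dedekindSymbol_of_natAbs_eq_one _ (by rcases hγ with rfl | rfl <;> simp)] at ih
      rw [hγ', hα] at *
      rcases hγ with rfl | rfl <;> simp at ih ⊢ <;> linarith
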